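/- With ℋ(a,b) as defined (via a Schwartz-class Ψ: ℝ⁶ → ℂ, M, T ≥ 1), for all (a,b) ∈ ℝ⁸ with |aᵢ|, |bᵢ| ≤ CM for all i, P ≠ 0 and Δ ≠ 0, the gradient of ℋ with respect to the eight variables (a,b) satisfies ‖∇ℋ(a,b)‖ ≪_{Ψ,C} (T²|Δ|)^{−1} · (1/M + M³/|Δ|). -/

import Mathlib

open MeasureTheory
open scoped SchwartzMap

noncomputable section

/-- The oscillatory integral `ℋ(a,b)` attached to a Schwartz function `Ψ` on `ℝ⁶`, viewed
as a function of `v ∈ ℝ⁸` with `(a₁,a₂,a₃,a₄) = (v 0, v 1, v 2, v 3)` and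
`(b₁,b₂,b₃,b₄) = (v 4, v 5, v 6, v 7)`. -/
def Hosc (Ψ : 𝓢(ℝ × ℝ × ℝ × ℝ × ℝ × ℝ, ℂ)) (M T : ℝ) (v : Fin 8 → ℝ) : ℂ :=
  ∫ u : ℝ, ∫ w : ℝ, ∫ z₁ : ℝ, ∫ z₂ : ℝ,
    Complex.exp (2 * Real.pi * Complex.I *
      (T * u / 2 * (v 0 * v 5 + v 1 * v 4) + T * w / 2 * (v 2 * v 7 + v 3 * v 6) +
        (z₁ * ((v 0 + v 1) * (v 4 + v 5)) - z₂ * ((v 2 + v 3) * (v 6 + v 7))) / (4 * M ^ 2))) *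
    Ψ (T * u * (v 4 * v 5) + T * w * (v 2 * v 3) +
         (z₁ * (v 4 + v 5) ^ 2 - z₂ * (v 2 + v 3) ^ 2) / (4 * M ^ 2),
       T * u * (v 0 * v 1) + T * w * (v 6 * v 7) +
         (z₁ * (v 0 + v 1) ^ 2 - z₂ * (v 6 + v 7) ^ 2) / (4 * M ^ 2),
       z₁, z₂, u, w)

/-- `P = max(|a₁a₂|, |a₃a₄|, |b₁b₂|, |b₃b₄|)`. -/
def Pmax (v : Fin 8 → ℝ) : ℝ :=
  max (max |v 0 * v 1| |v 2 * v 3|) (max |v 4 * v 5| |v 6 * v 7|)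

/-- `Δ = a₁a₂a₃a₄ - b₁b₂b₃b₄`. -/
def Δ₀ (v : Fin 8 → ℝ) : ℝ := v 0 * v 1 * v 2 * v 3 - v 4 * v 5 * v 6 * v 7

end

/-- An integrable weight on the plane. -/
noncomputable def planeWeight (q : ℝ × ℝ) : ℝ := (1 + q.1 ^ 2)⁻¹ * (1 + q.2 ^ 2)⁻¹

lemma planeWeight_nonneg (q : ℝ × ℝ) : 0 ≤ planeWeight q := by
  unfold planeWeight; positivity

lemma continuous_planeWeight : Continuous planeWeight := by
  unfold planeWeight
  refine Continuous.mul (Continuous.inv₀ (by fun_prop) fun q => ?_)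
    (Continuous.inv₀ (by fun_prop) fun q => ?_) <;> positivity

lemma integrable_planeWeight : Integrable planeWeight :=
  integrable_inv_one_add_sq.mul_prod integrable_inv_one_add_sq

lemma lintegral_comp_affine {α β γ δ : ℝ} (s t : ℝ) (h : α * δ - β * γ ≠ 0)
    {f : ℝ × ℝ → ENNReal} (hf : Measurable f) :
    ∫⁻ x : ℝ × ℝ, f (α * x.1 + β * x.2 + s, γ * x.1 + δ * x.2 + t) =
      ENNReal.ofReal |(α * δ - β * γ)⁻¹| * ∫⁻ x, f x := by
  set A := Matrix.toLin (Module.Basis.finTwoProd ℝ) (Module.Basis.finTwoProd ℝ) !![α, β; γ, δ]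
    with hA
  have hdet : LinearMap.det A = α * δ - β * γ := by
    rw [hA, LinearMap.det_toLin, Matrix.det_fin_two_of]
  have hmap := Measure.map_linearMap_addHaar_eq_smul_addHaar
    (volume : Measure (ℝ × ℝ)) (f := A) (by rwa [hdet])
  rw [hdet] at hmap
  have hAm : Measurable A := A.continuous_of_finiteDimensional.measurable
  calc ∫⁻ x : ℝ × ℝ, f (α * x.1 + β * x.2 + s, γ * x.1 + δ * x.2 + t)
      = ∫⁻ x : ℝ × ℝ, f (A x + (s, t)) := by
        simp only [hA, Matrix.toLin_finTwoProd_apply, Prod.mk_add_mk]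
    _ = ∫⁻ y, f (y + (s, t)) ∂(Measure.map A volume) := by
        exact (lintegral_map (hf.comp (measurable_add_const _)) hAm).symm
    _ = _ := by
        rw [hmap, lintegral_smul_measure, lintegral_add_right_eq_self, smul_eq_mul]

/-- The weight `planeWeight` pulled back along a skew affine map of the plane, times
`planeWeight` of the base point. -/
lemma integral_skew_planeWeight {α β γ δ : ℝ} (h : α * δ - β * γ ≠ 0) {s t : ℝ × ℝ → ℝ}
    (hs : Continuous s) (ht : Continuous t) :
    Integrable (fun p : (ℝ × ℝ) × (ℝ × ℝ) =>
        planeWeight (α * p.1.1 + β * p.1.2 + s p.2, γ * p.1.1 + δ * p.1.2 + t p.2) *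
          planeWeight p.2) ∧
      ∫ p : (ℝ × ℝ) × (ℝ × ℝ),
        planeWeight (α * p.1.1 + β * p.1.2 + s p.2, γ * p.1.1 + δ * p.1.2 + t p.2) *
          planeWeight p.2 = |α * δ - β * γ|⁻¹ * (∫ q, planeWeight q) ^ 2 := by
  set g : (ℝ × ℝ) × (ℝ × ℝ) → ℝ := fun p =>
    planeWeight (α * p.1.1 + β * p.1.2 + s p.2, γ * p.1.1 + δ * p.1.2 + t p.2) * planeWeight p.2
    with hg
  have hgc : Continuous g := by
    refine Continuous.mul (continuous_planeWeight.comp ?_) (continuous_planeWeight.comp ?_) <;>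
      fun_prop
  have hg0 : ∀ p, 0 ≤ g p := fun p => mul_nonneg (planeWeight_nonneg _) (planeWeight_nonneg _)
  set J := ∫ q, planeWeight q with hJ
  have hJ0 : 0 ≤ J := integral_nonneg planeWeight_nonneg
  have hmw : Measurable fun q => ENNReal.ofReal (planeWeight q) :=
    continuous_planeWeight.measurable.ennreal_ofReal
  have hJl : ∫⁻ q, ENNReal.ofReal (planeWeight q) = ENNReal.ofReal J :=
    (ofReal_integral_eq_lintegral_ofReal integrable_planeWeight
      (Filter.Eventually.of_forall planeWeight_nonneg)).symm
  have hl : ∫⁻ p, ENNReal.ofReal (g p) = ENNReal.ofReal (|α * δ - β * γ|⁻¹ * J ^ 2) := by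
    rw [Measure.volume_eq_prod, lintegral_prod_symm _ hgc.measurable.ennreal_ofReal.aemeasurable]
    have key : ∀ y : ℝ × ℝ, ∫⁻ x : ℝ × ℝ, ENNReal.ofReal (g (x, y)) =
        ENNReal.ofReal |(α * δ - β * γ)⁻¹| * ENNReal.ofReal J *
          ENNReal.ofReal (planeWeight y) := by
      intro y
      simp only [hg, ENNReal.ofReal_mul (planeWeight_nonneg _)]
      rw [lintegral_mul_const' _ _ ENNReal.ofReal_ne_top,
        lintegral_comp_affine (s y) (t y) h hmw, hJl]
    simp only [key]
    rw [lintegral_const_mul _ hmw, hJl, ← ENNReal.ofReal_mul (abs_nonneg _),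
      ← ENNReal.ofReal_mul (by positivity), abs_inv]
    congr 1; ring
  have hint : Integrable g := by
    refine ⟨hgc.aestronglyMeasurable, ?_⟩
    rw [hasFiniteIntegral_iff_ofReal (Filter.Eventually.of_forall hg0), hl]
    exact ENNReal.ofReal_lt_top
  refine ⟨hint, ?_⟩
  rw [integral_eq_lintegral_of_nonneg_ae (Filter.Eventually.of_forall hg0)
    hgc.aestronglyMeasurable, hl, ENNReal.toReal_ofReal (by positivity)]

lemma integral_iterated_four {f : (ℝ × ℝ) × (ℝ × ℝ) → ℂ} (hf : Integrable f) :
    ∫ u : ℝ, ∫ w : ℝ, ∫ z₁ : ℝ, ∫ z₂ : ℝ, f ((u, w), (z₁, z₂)) = ∫ p, f p := by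
  rw [Measure.volume_eq_prod] at hf
  have h₁ : ∫ p, f p = ∫ x : ℝ × ℝ, ∫ y : ℝ × ℝ, f (x, y) := integral_prod f hf
  have h₂ : ∫ x : ℝ × ℝ, ∫ y : ℝ × ℝ, f (x, y) = ∫ u : ℝ, ∫ w : ℝ, ∫ y : ℝ × ℝ, f ((u, w), y) :=
    integral_prod _ hf.integral_prod_left
  have hae := Measure.ae_ae_of_ae_prod hf.prod_right_ae
  rw [h₁, h₂]
  refine integral_congr_ae (hae.mono fun u hu => integral_congr_ae (hu.mono fun w hw => ?_))
  exact (integral_prod _ hw).symm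

lemma schwartz_decay {E : Type*} [NormedAddCommGroup E] [NormedSpace ℝ E] (Ψ : 𝓢(E, ℂ)) (k : ℕ) :
    ∃ B : ℝ, 0 < B ∧ ∀ (q : E) (N : ℝ), 0 < N → N ≤ 8 * (1 + ‖q‖) →
      ‖Ψ q‖ ≤ B / N ^ k ∧ ‖fderiv ℝ Ψ q‖ ≤ B / N ^ k := by
  set B₀ : ℝ := 2 ^ k * ((Finset.Iic (k, 1)).sup fun m => SchwartzMap.seminorm ℝ m.1 m.2) Ψ
  have hB₀ : 0 ≤ B₀ := by positivity
  have bound : ∀ (n : ℕ), n ≤ 1 → ∀ (q : E) (N : ℝ), 0 < N → N ≤ 8 * (1 + ‖q‖) →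
      ‖iteratedFDeriv ℝ n Ψ q‖ ≤ (8 ^ k * B₀ + 1) / N ^ k := by
    intro n hn q N hN hq
    have h := SchwartzMap.one_add_le_sup_seminorm_apply (𝕜 := ℝ) (m := (k, 1)) le_rfl hn Ψ q
    rw [le_div_iff₀ (by positivity)]
    calc ‖iteratedFDeriv ℝ n Ψ q‖ * N ^ k
        ≤ ‖iteratedFDeriv ℝ n Ψ q‖ * (8 * (1 + ‖q‖)) ^ k := by gcongr
      _ = 8 ^ k * ((1 + ‖q‖) ^ k * ‖iteratedFDeriv ℝ n Ψ q‖) := by rw [mul_pow]; ring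
      _ ≤ 8 ^ k * B₀ := by gcongr
      _ ≤ _ := by linarith
  refine ⟨8 ^ k * B₀ + 1, by positivity, fun q N hN hq => ⟨?_, ?_⟩⟩
  · simpa only [norm_iteratedFDeriv_zero] using bound 0 zero_le_one q N hN hq
  · simpa only [norm_iteratedFDeriv_one] using bound 1 le_rfl q N hN hq

lemma norm_exp_sub_exp_le (x y : ℝ) :
    ‖Complex.exp (x * Complex.I) - Complex.exp (y * Complex.I)‖ ≤ |x - y| := by
  have h : Complex.exp (x * Complex.I) - Complex.exp (y * Complex.I) =
      Complex.exp (y * Complex.I) * (Complex.exp (Complex.I * ((x - y : ℝ) : ℂ)) - 1) := by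
    rw [mul_sub, ← Complex.exp_add, mul_one]
    congr 2
    push_cast
    ring
  rw [h, norm_mul, Complex.norm_exp_ofReal_mul_I, one_mul]
  exact Real.norm_exp_I_mul_ofReal_sub_one_le

/-- Lipschitz bound for `x ↦ e^{ix} Ψ(q)` near a point `q` of size about `N`. -/
lemma norm_exp_mul_sub_le {E : Type*} [NormedAddCommGroup E] [NormedSpace ℝ E] {Ψ : 𝓢(E, ℂ)}
    {k : ℕ} {B : ℝ}
    (hB : ∀ (q : E) (N : ℝ), 0 < N → N ≤ 8 * (1 + ‖q‖) →
      ‖Ψ q‖ ≤ B / N ^ k ∧ ‖fderiv ℝ Ψ q‖ ≤ B / N ^ k)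
    {q q' : E} {N : ℝ} (hN : 0 < N) (hq : N ≤ 4 * (1 + ‖q‖)) (hq' : ‖q' - q‖ ≤ N / 8)
    (x x' : ℝ) :
    ‖Ψ q'‖ ≤ B / N ^ k ∧
    ‖Complex.exp (x' * Complex.I) * Ψ q' - Complex.exp (x * Complex.I) * Ψ q‖ ≤
      (|x' - x| + ‖q' - q‖) * (B / N ^ k) := by
  have hball : ∀ r ∈ Metric.closedBall q (N / 8), N ≤ 8 * (1 + ‖r‖) := by
    intro r hr
    rw [mem_closedBall_iff_norm] at hr
    have := norm_sub_norm_le q r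
    rw [norm_sub_rev] at this
    linarith
  have hq'm : q' ∈ Metric.closedBall q (N / 8) := mem_closedBall_iff_norm.2 hq'
  have hqm : q ∈ Metric.closedBall q (N / 8) := Metric.mem_closedBall_self (by positivity)
  have hΨ := (hB q' N hN (hball q' hq'm)).1
  refine ⟨hΨ, ?_⟩
  have hlip : ‖Ψ q' - Ψ q‖ ≤ B / N ^ k * ‖q' - q‖ :=
    (convex_closedBall q (N / 8)).norm_image_sub_le_of_norm_fderiv_le
      (fun r _ => Ψ.differentiableAt) (fun r hr => (hB r N hN (hball r hr)).2) hqm hq'm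
  calc ‖Complex.exp (x' * Complex.I) * Ψ q' - Complex.exp (x * Complex.I) * Ψ q‖
      = ‖(Complex.exp (x' * Complex.I) - Complex.exp (x * Complex.I)) * Ψ q' +
          Complex.exp (x * Complex.I) * (Ψ q' - Ψ q)‖ := by congr 1; ring
    _ ≤ |x' - x| * (B / N ^ k) + 1 * (B / N ^ k * ‖q' - q‖) := by
        refine (norm_add_le _ _).trans ?_
        rw [norm_mul, norm_mul, Complex.norm_exp_ofReal_mul_I]
        gcongr
        exact norm_exp_sub_exp_le x' x
    _ = _ := by ring

lemma inv_pow_eight_le {N x y z w : ℝ} (hN : 1 + |x| + |y| + |z| + |w| ≤ N) :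
    (N ^ 8)⁻¹ ≤ planeWeight (x, y) * planeWeight (z, w) := by
  have h0 : 0 ≤ N := by
    linarith [abs_nonneg x, abs_nonneg y, abs_nonneg z, abs_nonneg w]
  have h : ∀ t : ℝ, 1 + |t| ≤ N → 1 + t ^ 2 ≤ N ^ 2 := by
    intro t ht
    have := abs_nonneg t
    rw [← sq_abs t]
    nlinarith
  have hx := h x (by linarith [abs_nonneg y, abs_nonneg z, abs_nonneg w])
  have hy := h y (by linarith [abs_nonneg x, abs_nonneg z, abs_nonneg w])
  have hz := h z (by linarith [abs_nonneg y, abs_nonneg x, abs_nonneg w])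
  have hw := h w (by linarith [abs_nonneg y, abs_nonneg z, abs_nonneg x])
  simp only [planeWeight, ← mul_inv]
  refine inv_anti₀ (by positivity) ?_
  calc (1 + x ^ 2) * (1 + y ^ 2) * ((1 + z ^ 2) * (1 + w ^ 2))
      ≤ N ^ 2 * N ^ 2 * (N ^ 2 * N ^ 2) := by gcongr
    _ = N ^ 8 := by ring

/-- The linear form in the four integration variables out of which phase and argument of the
integrand are built. -/
noncomputable def oscForm (M T A B C D : ℝ) (p : (ℝ × ℝ) × (ℝ × ℝ)) : ℝ :=
  T * p.1.1 * A + T * p.1.2 * B + (p.2.1 * C - p.2.2 * D) / (4 * M ^ 2)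

lemma oscForm_sub_le {M T A B C D A' B' C' D' U Z η : ℝ} {p : (ℝ × ℝ) × (ℝ × ℝ)}
    (hM : 0 < M) (hu : |T * p.1.1| ≤ U) (hw : |T * p.1.2| ≤ U) (hz₁ : |p.2.1| ≤ Z)
    (hz₂ : |p.2.2| ≤ Z) (hA : |A' - A| ≤ η) (hB : |B' - B| ≤ η) (hC : |C' - C| ≤ 4 * η)
    (hD : |D' - D| ≤ 4 * η) :
    |oscForm M T A' B' C' D' p - oscForm M T A B C D p| ≤ 2 * η * (U + Z / M ^ 2) := by
  have hU : 0 ≤ U := (abs_nonneg _).trans hu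
  have hZ : 0 ≤ Z := (abs_nonneg _).trans hz₁
  have h : oscForm M T A' B' C' D' p - oscForm M T A B C D p =
      T * p.1.1 * (A' - A) + T * p.1.2 * (B' - B) +
        (p.2.1 * (C' - C) - p.2.2 * (D' - D)) / (4 * M ^ 2) := by
    unfold oscForm; ring
  have h₁ : |T * p.1.1 * (A' - A)| ≤ U * η := by rw [abs_mul]; gcongr
  have h₂ : |T * p.1.2 * (B' - B)| ≤ U * η := by rw [abs_mul]; gcongr
  have h₃ : |p.2.1 * (C' - C)| ≤ Z * (4 * η) := by rw [abs_mul]; gcongr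
  have h₄ : |p.2.2 * (D' - D)| ≤ Z * (4 * η) := by rw [abs_mul]; gcongr
  have h₅ : |(p.2.1 * (C' - C) - p.2.2 * (D' - D)) / (4 * M ^ 2)| ≤
      (Z * (4 * η) + Z * (4 * η)) / (4 * M ^ 2) := by
    rw [abs_div, abs_of_pos (show 0 < 4 * M ^ 2 by positivity)]
    gcongr
    exact (abs_sub _ _).trans (add_le_add h₃ h₄)
  rw [h]
  refine ((abs_add_le _ _).trans (add_le_add ((abs_add_le _ _).trans
    (add_le_add h₁ h₂)) h₅)).trans (le_of_eq ?_)
  field_simp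
  ring

lemma abs_mul_sub_mul_le {x y x' y' A ε : ℝ} (hA : 0 ≤ A) (hx : |x| ≤ A) (hy' : |y'| ≤ 2 * A)
    (hxx : |x' - x| ≤ ε) (hyy : |y' - y| ≤ ε) : |x' * y' - x * y| ≤ 3 * A * ε := by
  have h : x' * y' - x * y = (x' - x) * y' + x * (y' - y) := by ring
  have hε : 0 ≤ ε := (abs_nonneg _).trans hxx
  rw [h]
  refine (abs_add_le _ _).trans ?_
  rw [abs_mul, abs_mul]
  calc |x' - x| * |y'| + |x| * |y' - y| ≤ ε * (2 * A) + A * ε := by gcongr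
    _ = _ := by ring

/-- The phase of `Hosc`, without the factor `2π`. -/
noncomputable def oscPhase (M T : ℝ) (v : Fin 8 → ℝ) (p : (ℝ × ℝ) × (ℝ × ℝ)) : ℝ :=
  oscForm M T ((v 0 * v 5 + v 1 * v 4) / 2) ((v 2 * v 7 + v 3 * v 6) / 2)
    ((v 0 + v 1) * (v 4 + v 5)) ((v 2 + v 3) * (v 6 + v 7)) p

/-- The first argument of `Ψ` in `Hosc`. -/
noncomputable def oscX (M T : ℝ) (v : Fin 8 → ℝ) (p : (ℝ × ℝ) × (ℝ × ℝ)) : ℝ :=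
  oscForm M T (v 4 * v 5) (v 2 * v 3) ((v 4 + v 5) ^ 2) ((v 2 + v 3) ^ 2) p

/-- The second argument of `Ψ` in `Hosc`. -/
noncomputable def oscY (M T : ℝ) (v : Fin 8 → ℝ) (p : (ℝ × ℝ) × (ℝ × ℝ)) : ℝ :=
  oscForm M T (v 0 * v 1) (v 6 * v 7) ((v 0 + v 1) ^ 2) ((v 6 + v 7) ^ 2) p

/-- The argument of `Ψ` in `Hosc`. -/
noncomputable def oscArg (M T : ℝ) (v : Fin 8 → ℝ) (p : (ℝ × ℝ) × (ℝ × ℝ)) :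
    ℝ × ℝ × ℝ × ℝ × ℝ × ℝ :=
  (oscX M T v p, oscY M T v p, p.2.1, p.2.2, p.1.1, p.1.2)

/-- The integrand of `Hosc`. -/
noncomputable def oscIntegrand (Ψ : 𝓢(ℝ × ℝ × ℝ × ℝ × ℝ × ℝ, ℂ)) (M T : ℝ) (v : Fin 8 → ℝ)
    (p : (ℝ × ℝ) × (ℝ × ℝ)) : ℂ :=
  Complex.exp ((2 * Real.pi * oscPhase M T v p : ℝ) * Complex.I) * Ψ (oscArg M T v p)

/-- The size of the part of `oscArg` that controls all integration variables. -/
noncomputable def oscSize (M T : ℝ) (v : Fin 8 → ℝ) (p : (ℝ × ℝ) × (ℝ × ℝ)) : ℝ :=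
  1 + |oscX M T v p| + |oscY M T v p| + |p.2.1| + |p.2.2|

lemma continuous_oscIntegrand (Ψ : 𝓢(ℝ × ℝ × ℝ × ℝ × ℝ × ℝ, ℂ)) (M T : ℝ) (v : Fin 8 → ℝ) :
    Continuous (oscIntegrand Ψ M T v) := by
  unfold oscIntegrand oscPhase oscArg oscX oscY oscForm
  refine Continuous.mul (by fun_prop) (Ψ.continuous.comp (by fun_prop))

lemma Hosc_eq_integral {Ψ : 𝓢(ℝ × ℝ × ℝ × ℝ × ℝ × ℝ, ℂ)} {M T : ℝ} {v : Fin 8 → ℝ}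
    (h : Integrable (oscIntegrand Ψ M T v)) :
    Hosc Ψ M T v = ∫ p, oscIntegrand Ψ M T v p := by
  rw [← integral_iterated_four h]
  unfold Hosc oscIntegrand oscPhase oscArg oscX oscY oscForm
  congr! 9
  congr 1
  push_cast
  ring

lemma one_le_oscSize (M T : ℝ) (v : Fin 8 → ℝ) (p : (ℝ × ℝ) × (ℝ × ℝ)) :
    1 ≤ oscSize M T v p := by
  unfold oscSize
  linarith [abs_nonneg (oscX M T v p), abs_nonneg (oscY M T v p), abs_nonneg p.2.1,
    abs_nonneg p.2.2]

lemma oscSize_le (M T : ℝ) (v : Fin 8 → ℝ) (p : (ℝ × ℝ) × (ℝ × ℝ)) :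
    oscSize M T v p ≤ 4 * (1 + ‖oscArg M T v p‖) := by
  have h₁ : |oscX M T v p| ≤ ‖oscArg M T v p‖ := by simp [oscArg, Prod.norm_def]
  have h₂ : |oscY M T v p| ≤ ‖oscArg M T v p‖ := by simp [oscArg, Prod.norm_def]
  have h₃ : |p.2.1| ≤ ‖oscArg M T v p‖ := by simp [oscArg, Prod.norm_def]
  have h₄ : |p.2.2| ≤ ‖oscArg M T v p‖ := by simp [oscArg, Prod.norm_def]
  unfold oscSize
  linarith

/-- Cramer's rule for a pair of linear forms, as an inequality. -/
lemma abs_mul_det_le {α β γ δ x y s t Q r X Y : ℝ} (hβ : |β| ≤ Q) (hδ : |δ| ≤ Q)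
    (hX : X = x * α + y * β + s) (hY : Y = x * γ + y * δ + t) (hs : |s| ≤ r) (ht : |t| ≤ r) :
    |x| * |α * δ - β * γ| ≤ Q * (|X| + |Y| + 2 * r) := by
  have hQ : 0 ≤ Q := (abs_nonneg _).trans hβ
  have h : x * (α * δ - β * γ) = δ * (X - s) - β * (Y - t) := by rw [hX, hY]; ring
  rw [← abs_mul, h]
  calc |δ * (X - s) - β * (Y - t)| ≤ |δ| * |X - s| + |β| * |Y - t| := by
        rw [← abs_mul, ← abs_mul]; exact abs_sub _ _
    _ ≤ Q * (|X| + r) + Q * (|Y| + r) := by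
        gcongr
        · exact (abs_sub _ _).trans (by gcongr)
        · exact (abs_sub _ _).trans (by gcongr)
    _ = _ := by ring

lemma abs_sub_div_le {M K z₁ z₂ c d : ℝ} (hM : 0 < M) (hc : |c| ≤ 2 * K * M)
    (hd : |d| ≤ 2 * K * M) :
    |(z₁ * c ^ 2 - z₂ * d ^ 2) / (4 * M ^ 2)| ≤ K ^ 2 * (|z₁| + |z₂|) := by
  have hsq : ∀ t : ℝ, |t| ≤ 2 * K * M → t ^ 2 ≤ (2 * K * M) ^ 2 := fun t ht => by
    rw [← sq_abs]; gcongr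
  rw [abs_div, abs_of_pos (show 0 < 4 * M ^ 2 by positivity), div_le_iff₀ (by positivity)]
  calc |z₁ * c ^ 2 - z₂ * d ^ 2| ≤ |z₁| * c ^ 2 + |z₂| * d ^ 2 := by
        refine (abs_sub _ _).trans (le_of_eq ?_)
        rw [abs_mul, abs_mul, abs_of_nonneg (sq_nonneg c), abs_of_nonneg (sq_nonneg d)]
    _ ≤ |z₁| * (2 * K * M) ^ 2 + |z₂| * (2 * K * M) ^ 2 := by
        exact add_le_add (mul_le_mul_of_nonneg_left (hsq c hc) (abs_nonneg _))
          (mul_le_mul_of_nonneg_left (hsq d hd) (abs_nonneg _))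
    _ = _ := by ring

lemma abs_integration_variables_le {M T K : ℝ} {v : Fin 8 → ℝ} (hM : 1 ≤ M) (hK : 1 ≤ K)
    (hv : ∀ i, |v i| ≤ K * M) (hΔ : Δ₀ v ≠ 0) (p : (ℝ × ℝ) × (ℝ × ℝ)) :
    |T * p.1.1| ≤ 2 * K ^ 4 * M ^ 2 * oscSize M T v p / |Δ₀ v| ∧
      |T * p.1.2| ≤ 2 * K ^ 4 * M ^ 2 * oscSize M T v p / |Δ₀ v| := by
  have hM0 : 0 < M := by linarith
  have hΔ0 : 0 < |Δ₀ v| := abs_pos.2 hΔ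
  have hmul : ∀ i j, |v i * v j| ≤ K ^ 2 * M ^ 2 := fun i j => by
    rw [abs_mul]
    calc |v i| * |v j| ≤ (K * M) * (K * M) := by gcongr <;> exact hv _
      _ = _ := by ring
  have hadd : ∀ i j, |v i + v j| ≤ 2 * K * M := fun i j =>
    (abs_add_le _ _).trans (by linarith [hv i, hv j])
  have hs := abs_sub_div_le (z₁ := p.2.1) (z₂ := p.2.2) hM0 (hadd 4 5) (hadd 2 3)
  have ht := abs_sub_div_le (z₁ := p.2.1) (z₂ := p.2.2) hM0 (hadd 0 1) (hadd 6 7)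
  have hsize : K ^ 2 * M ^ 2 * (|oscX M T v p| + |oscY M T v p| +
      2 * (K ^ 2 * (|p.2.1| + |p.2.2|))) ≤ 2 * K ^ 4 * M ^ 2 * oscSize M T v p := by
    have hK2 : 1 ≤ K ^ 2 := one_le_pow₀ hK
    have hX := abs_nonneg (oscX M T v p)
    have hY := abs_nonneg (oscY M T v p)
    have : |oscX M T v p| + |oscY M T v p| + 2 * (K ^ 2 * (|p.2.1| + |p.2.2|)) ≤
        2 * K ^ 2 * oscSize M T v p := by
      unfold oscSize
      nlinarith
    calc _ ≤ K ^ 2 * M ^ 2 * (2 * K ^ 2 * oscSize M T v p) := by gcongr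
      _ = _ := by ring
  constructor
  · rw [le_div_iff₀ hΔ0]
    refine le_trans ?_ hsize
    have h := abs_mul_det_le (x := T * p.1.1) (y := T * p.1.2) (X := oscX M T v p)
      (Y := oscY M T v p) (hmul 2 3) (hmul 6 7) rfl rfl hs ht
    rwa [show |Δ₀ v| = |v 4 * v 5 * (v 6 * v 7) - v 2 * v 3 * (v 0 * v 1)| by
      rw [abs_sub_comm]; unfold Δ₀; ring_nf]
  · rw [le_div_iff₀ hΔ0]
    refine le_trans ?_ hsize
    have h := abs_mul_det_le (x := T * p.1.2) (y := T * p.1.1) (X := oscX M T v p)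
      (Y := oscY M T v p) (α := v 2 * v 3) (γ := v 6 * v 7) (hmul 4 5) (hmul 0 1)
      (by unfold oscX oscForm; ring) (by unfold oscY oscForm; ring) hs ht
    rwa [show |Δ₀ v| = |v 2 * v 3 * (v 0 * v 1) - v 4 * v 5 * (v 6 * v 7)| by
      unfold Δ₀; ring_nf]

/-- Phase and argument of the integrand are Lipschitz in `v`, relative to `oscSize`. -/
lemma osc_sub_le {M T K ε : ℝ} {v v' : Fin 8 → ℝ} (hM : 1 ≤ M) (hK : 1 ≤ K)
    (hv : ∀ i, |v i| ≤ K * M) (hΔ : Δ₀ v ≠ 0) (hε : ε ≤ K * M) (hvv : ∀ i, |v' i - v i| ≤ ε)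
    (p : (ℝ × ℝ) × (ℝ × ℝ)) :
    |oscPhase M T v' p - oscPhase M T v p| ≤
        12 * K ^ 5 * (1 / M + M ^ 3 / |Δ₀ v|) * ε * oscSize M T v p ∧
      ‖oscArg M T v' p - oscArg M T v p‖ ≤
        12 * K ^ 5 * (1 / M + M ^ 3 / |Δ₀ v|) * ε * oscSize M T v p := by
  have hM0 : 0 < M := by linarith
  have hK0 : 0 < K := by linarith
  have hΔ0 : 0 < |Δ₀ v| := abs_pos.2 hΔ
  have hε0 : 0 ≤ ε := (abs_nonneg _).trans (hvv 0)
  have hN := one_le_oscSize M T v p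
  have hKM : 0 ≤ K * M := by positivity
  have hv' : ∀ i, |v' i| ≤ 2 * (K * M) := fun i => by
    have := abs_sub_abs_le_abs_sub (v' i) (v i)
    linarith [hvv i, hv i]
  have hmul : ∀ i j, |v' i * v' j - v i * v j| ≤ 3 * (K * M) * ε := fun i j =>
    abs_mul_sub_mul_le hKM (hv i) (hv' j) (hvv i) (hvv j)
  have hadd : ∀ i j, |v i + v j| ≤ 2 * (K * M) := fun i j =>
    (abs_add_le _ _).trans (by linarith [hv i, hv j])
  have hadd' : ∀ i j, |v' i + v' j| ≤ 2 * (2 * (K * M)) := fun i j =>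
    (abs_add_le _ _).trans (by linarith [hv' i, hv' j])
  have hsub : ∀ i j, |v' i + v' j - (v i + v j)| ≤ 2 * ε := fun i j => by
    rw [add_sub_add_comm]
    exact (abs_add_le _ _).trans (by linarith [hvv i, hvv j])
  have hsum : ∀ i j k l, |(v' i + v' j) * (v' k + v' l) - (v i + v j) * (v k + v l)| ≤
      4 * (3 * (K * M) * ε) := fun i j k l =>
    (abs_mul_sub_mul_le (by positivity) (hadd i j) (hadd' k l) (hsub i j) (hsub k l)).trans
      (le_of_eq (by ring))
  have hsq : ∀ i j, |(v' i + v' j) ^ 2 - (v i + v j) ^ 2| ≤ 4 * (3 * (K * M) * ε) :=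
    fun i j => by simpa only [sq] using hsum i j i j
  have havg : ∀ i j k l, |(v' i * v' j + v' k * v' l) / 2 - (v i * v j + v k * v l) / 2| ≤
      3 * (K * M) * ε := fun i j k l => by
    have h₁ := abs_le.1 (hmul i j)
    have h₂ := abs_le.1 (hmul k l)
    rw [abs_le]
    constructor <;> linarith [h₁.1, h₁.2, h₂.1, h₂.2]
  obtain ⟨hu, hw⟩ := abs_integration_variables_le (T := T) hM hK hv hΔ p
  have hz₁ : |p.2.1| ≤ oscSize M T v p := by
    unfold oscSize
    linarith [abs_nonneg (oscX M T v p), abs_nonneg (oscY M T v p), abs_nonneg p.2.2]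
  have hz₂ : |p.2.2| ≤ oscSize M T v p := by
    unfold oscSize
    linarith [abs_nonneg (oscX M T v p), abs_nonneg (oscY M T v p), abs_nonneg p.2.1]
  have hfin : 2 * (3 * (K * M) * ε) * (2 * K ^ 4 * M ^ 2 * oscSize M T v p / |Δ₀ v| +
      oscSize M T v p / M ^ 2) ≤
      12 * K ^ 5 * (1 / M + M ^ 3 / |Δ₀ v|) * ε * oscSize M T v p := by
    have hKK : 6 * K ≤ 12 * K ^ 5 := by
      have : K ≤ K ^ 5 := le_self_pow₀ hK (by norm_num)
      linarith
    calc _ = 12 * K ^ 5 * (M ^ 3 / |Δ₀ v|) * ε * oscSize M T v p +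
          6 * K * (1 / M) * ε * oscSize M T v p := by
          field_simp
          ring
      _ ≤ 12 * K ^ 5 * (M ^ 3 / |Δ₀ v|) * ε * oscSize M T v p +
          12 * K ^ 5 * (1 / M) * ε * oscSize M T v p := by gcongr
      _ = _ := by ring
  refine ⟨(oscForm_sub_le hM0 hu hw hz₁ hz₂ (havg _ _ _ _) (havg _ _ _ _) (hsum _ _ _ _)
    (hsum _ _ _ _)).trans hfin, ?_⟩
  have hX : |oscX M T v' p - oscX M T v p| ≤ _ :=
    (oscForm_sub_le hM0 hu hw hz₁ hz₂ (hmul _ _) (hmul _ _) (hsq _ _) (hsq _ _)).trans hfin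
  have hY : |oscY M T v' p - oscY M T v p| ≤ _ :=
    (oscForm_sub_le hM0 hu hw hz₁ hz₂ (hmul _ _) (hmul _ _) (hsq _ _) (hsq _ _)).trans hfin
  have h0 := (abs_nonneg _).trans hX
  simp only [oscArg, Prod.mk_sub_mk, Prod.norm_mk, sub_self, norm_zero, Real.norm_eq_abs]
  exact max_le hX (max_le hY h0)

/-- **Bound (2.12).** For all `(a,b) ∈ ℝ⁸` with `|aᵢ|, |bᵢ| ≤ CM`, `P ≠ 0` and `Δ ≠ 0`,
the gradient of `ℋ` in the eight variables satisfies
`‖∇ℋ(a,b)‖ ≪_{Ψ,C} (T²|Δ|)⁻¹ (1/M + M³/|Δ|)`. -/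
theorem Hosc_gradient_bound (Ψ : 𝓢(ℝ × ℝ × ℝ × ℝ × ℝ × ℝ, ℂ)) (Cb : ℝ) (hCb : 1 ≤ Cb) :
    ∃ C : ℝ, 0 < C ∧ ∀ M T : ℝ, ∀ v : Fin 8 → ℝ, 1 ≤ M → 1 ≤ T →
      (∀ i, |v i| ≤ Cb * M) → Pmax v ≠ 0 → Δ₀ v ≠ 0 →
      ‖fderiv ℝ (Hosc Ψ M T) v‖ ≤
        C * (T ^ 2 * |Δ₀ v|)⁻¹ * (1 / M + M ^ 3 / |Δ₀ v|) := by
  obtain ⟨B, hB0, hB⟩ := schwartz_decay Ψ 9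
  set J := ∫ q, planeWeight q with hJ
  refine ⟨(2 * Real.pi + 1) * (12 * Cb ^ 5) * B * (J ^ 2 + 1), by positivity, ?_⟩
  intro M T v hM hT hv _ hΔ
  have hM0 : 0 < M := by linarith
  have hT0 : 0 < T := by linarith
  have hΔ0 : 0 < |Δ₀ v| := abs_pos.2 hΔ
  set R := 1 / M + M ^ 3 / |Δ₀ v| with hR
  have hR0 : 0 < R := by positivity
  set L := 12 * Cb ^ 5 * R with hL
  have hL0 : 0 < L := by positivity
  have hdet : T * (v 4 * v 5) * (T * (v 6 * v 7)) - T * (v 2 * v 3) * (T * (v 0 * v 1)) =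
      -(T ^ 2 * Δ₀ v) := by unfold Δ₀; ring
  obtain ⟨hgi, hgv⟩ := integral_skew_planeWeight
    (s := fun z => (z.1 * (v 4 + v 5) ^ 2 - z.2 * (v 2 + v 3) ^ 2) / (4 * M ^ 2))
    (t := fun z => (z.1 * (v 0 + v 1) ^ 2 - z.2 * (v 6 + v 7) ^ 2) / (4 * M ^ 2))
    (by rw [hdet]; exact neg_ne_zero.2 (mul_ne_zero (by positivity) hΔ))
    (by fun_prop) (by fun_prop)
  set g : (ℝ × ℝ) × (ℝ × ℝ) → ℝ := fun p =>
    planeWeight (oscX M T v p, oscY M T v p) * planeWeight p.2 with hg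
  have hg_eq : (fun p : (ℝ × ℝ) × (ℝ × ℝ) => planeWeight
      (T * (v 4 * v 5) * p.1.1 + T * (v 2 * v 3) * p.1.2 +
          (p.2.1 * (v 4 + v 5) ^ 2 - p.2.2 * (v 2 + v 3) ^ 2) / (4 * M ^ 2),
        T * (v 0 * v 1) * p.1.1 + T * (v 6 * v 7) * p.1.2 +
          (p.2.1 * (v 0 + v 1) ^ 2 - p.2.2 * (v 6 + v 7) ^ 2) / (4 * M ^ 2)) *
      planeWeight p.2) = g := by
    funext p
    simp only [hg, oscX, oscY, oscForm]
    congr 3 <;> ring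
  rw [hg_eq] at hgi hgv
  rw [hdet, abs_neg, abs_mul, abs_of_pos (show 0 < T ^ 2 by positivity), ← hJ] at hgv
  have hNg : ∀ p, (oscSize M T v p ^ 8)⁻¹ ≤ g p := fun p => inv_pow_eight_le le_rfl
  have hpoint : ∀ v' : Fin 8 → ℝ, ‖v' - v‖ ≤ Cb * M → L * ‖v' - v‖ ≤ 1 / 8 → ∀ p,
      ‖oscIntegrand Ψ M T v' p‖ ≤ B * g p ∧
      ‖oscIntegrand Ψ M T v' p - oscIntegrand Ψ M T v p‖ ≤
        (2 * Real.pi + 1) * L * B * ‖v' - v‖ * g p := by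
    intro v' h₁ h₂ p
    obtain ⟨hph, harg⟩ := osc_sub_le (T := T) hM hCb hv hΔ h₁
      (fun i => norm_le_pi_norm (v' - v) i) p
    rw [← hR, ← hL] at hph harg
    have hN1 := one_le_oscSize M T v p
    have hNp := hNg p
    set N := oscSize M T v p with hN
    have hN0 : 0 < N := by linarith
    have hclose : ‖oscArg M T v' p - oscArg M T v p‖ ≤ N / 8 := by
      refine harg.trans ?_
      calc L * ‖v' - v‖ * N ≤ 1 / 8 * N := by gcongr
        _ = N / 8 := by ring
    obtain ⟨hval, hdiff⟩ := norm_exp_mul_sub_le hB hN0 (oscSize_le M T v p) hclose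
      (2 * Real.pi * oscPhase M T v p) (2 * Real.pi * oscPhase M T v' p)
    constructor
    · rw [oscIntegrand, norm_mul, Complex.norm_exp_ofReal_mul_I, one_mul]
      refine hval.trans ?_
      rw [div_eq_mul_inv]
      have : (N ^ 9)⁻¹ ≤ (N ^ 8)⁻¹ :=
        inv_anti₀ (by positivity) (pow_le_pow_right₀ hN1 (by norm_num))
      gcongr
      exact this.trans hNp
    · refine hdiff.trans ?_
      rw [← mul_sub, abs_mul, abs_of_pos Real.two_pi_pos]
      calc (2 * Real.pi * |oscPhase M T v' p - oscPhase M T v p| +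
            ‖oscArg M T v' p - oscArg M T v p‖) * (B / N ^ 9)
          ≤ (2 * Real.pi * (L * ‖v' - v‖ * N) + L * ‖v' - v‖ * N) * (B / N ^ 9) := by gcongr
        _ = (2 * Real.pi + 1) * L * B * ‖v' - v‖ * (N ^ 8)⁻¹ := by field_simp
        _ ≤ _ := by gcongr
  have hint : ∀ v' : Fin 8 → ℝ, ‖v' - v‖ ≤ Cb * M → L * ‖v' - v‖ ≤ 1 / 8 →
      Integrable (oscIntegrand Ψ M T v') := fun v' h₁ h₂ =>
    (hgi.const_mul B).mono' (continuous_oscIntegrand Ψ M T v').aestronglyMeasurable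
      (Filter.Eventually.of_forall fun p => (hpoint v' h₁ h₂ p).1)
  have hintv := hint v (by rw [sub_self, norm_zero]; positivity) (by simp)
  refine norm_fderiv_le_of_lip' ℝ (by positivity) ?_
  have hρ : 0 < min (Cb * M) (1 / 8 / L) := by positivity
  filter_upwards [Metric.ball_mem_nhds v hρ] with v' hv'
  rw [mem_ball_iff_norm] at hv'
  have h₁ : ‖v' - v‖ ≤ Cb * M := (hv'.trans_le (min_le_left _ _)).le
  have h₂ : L * ‖v' - v‖ ≤ 1 / 8 :=
    (le_div_iff₀' hL0).1 (hv'.trans_le (min_le_right _ _)).le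
  have hintv' := hint v' h₁ h₂
  rw [Hosc_eq_integral hintv', Hosc_eq_integral hintv, ← integral_sub hintv' hintv]
  calc ‖∫ p, (oscIntegrand Ψ M T v' p - oscIntegrand Ψ M T v p)‖
      ≤ ∫ p, (2 * Real.pi + 1) * L * B * ‖v' - v‖ * g p :=
        norm_integral_le_of_norm_le (hgi.const_mul _)
          (Filter.Eventually.of_forall fun p => (hpoint v' h₁ h₂ p).2)
    _ = (2 * Real.pi + 1) * L * B * ‖v' - v‖ * ((T ^ 2 * |Δ₀ v|)⁻¹ * J ^ 2) := by
        rw [integral_const_mul, hgv]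
    _ ≤ (2 * Real.pi + 1) * L * B * ‖v' - v‖ * ((T ^ 2 * |Δ₀ v|)⁻¹ * (J ^ 2 + 1)) := by
        gcongr
        linarith
    _ = _ := by rw [hL]; ring
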